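/- For every NPLCS N, location q and sets of locations B₁,…,Bₙ ⊆ Q: there exists a scheduler U with Pr_U((q,ε) ⊨ ⋁_{i=1}^n □Bᵢ) = 1 if and only if there exist an index i ∈ {1,…,n} and a blind, memoryless scheduler U' with Pr_{U'}((q,ε) ⊨ □Bᵢ) = 1. -/

import Mathlib

open scoped ENNReal
open Classical

namespace NPLCSmodel

/-! ## Lossy channel systems -/

/-- Operations of a lossy channel system: send a message on a channel,
receive a message from a channel, or an internal action. -/
inductive LcsOp (C M : Type) : Type where
  | send : C → M → LcsOp C M
  | recv : C → M → LcsOp C M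
  | internal : LcsOp C M

def LcsOp.IsRecv {C M : Type} : LcsOp C M → Prop
  | .recv _ _ => True
  | _ => False

/-- A transition rule `src --op--> dst`. -/
structure LcsRule (Q C M : Type) : Type where
  src : Q
  op : LcsOp C M
  dst : Q

/-- Channel contents: a word over `M` for each channel. -/
abbrev Chans (C M : Type) : Type := C → List M

/-- Configurations: a location together with channel contents. -/
abbrev Conf (Q C M : Type) : Type := Q × Chans C M

/-- The empty channel contents ε. -/
def eps (C M : Type) : Chans C M := fun _ => []

variable {Q C M : Type}

/-- When is an operation possible on channel contents `w`? -/
def enabledOp : LcsOp C M → Chans C M → Prop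
  | .recv c m, w => ∃ v, w c = m :: v
  | .send _ _, _ => True
  | .internal, _ => True

/-- Effect of an operation on the channel contents (for a perfect step). -/
def applyOp [DecidableEq C] : LcsOp C M → Chans C M → Chans C M
  | .send c m, w => Function.update w c (w c ++ [m])
  | .recv c _, w => Function.update w c (w c).tail
  | .internal, w => w

/-- A rule is enabled in a configuration. -/
def LcsRule.EnabledIn (δ : LcsRule Q C M) (s : Conf Q C M) : Prop :=
  δ.src = s.1 ∧ enabledOp δ.op s.2

/-- A lossy channel system `L = (Q, C, M, Δ)` (the finiteness of the location,
channel and message types is imposed by `Fintype` assumptions at use sites):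
a finite set of transition rules such that every location has at least one
outgoing rule that is not a receive. -/
structure LCS (Q C M : Type) : Type where
  rules : Set (LcsRule Q C M)
  finiteRules : rules.Finite
  noDeadlock : ∀ q : Q, ∃ δ ∈ rules, δ.src = q ∧ ¬ δ.op.IsRecv

variable [DecidableEq C]

/-- Lossy step via rule `δ`: a perfect step followed by losing arbitrarily
many messages (`<+` is the (componentwise) subword relation). -/
def LCS.StepVia (L : LCS Q C M) (s : Conf Q C M) (δ : LcsRule Q C M)
    (t : Conf Q C M) : Prop :=
  δ ∈ L.rules ∧ δ.EnabledIn s ∧ t.1 = δ.dst ∧ ∀ c, List.Sublist (t.2 c) (applyOp δ.op s.2 c)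

/-- Lossy step `s → t`. -/
def LCS.Step (L : LCS Q C M) (s t : Conf Q C M) : Prop := ∃ δ, L.StepVia s δ t

/-- Reachability `s →* t`. -/
def LCS.Reach (L : LCS Q C M) : Conf Q C M → Conf Q C M → Prop :=
  Relation.ReflTransGen L.Step

/-- Constrained reachability `s →*_[X) t`: all configurations along the path,
except possibly the last one, have their location in `X`. -/
def LCS.ReachWithin (L : LCS Q C M) (X : Set Q) : Conf Q C M → Conf Q C M → Prop :=
  Relation.ReflTransGen (fun a b => L.Step a b ∧ a.1 ∈ X)

/-- Constrained reachability `s →*_[X] t`: all configurations along the path,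
including `s` and `t`, have their location in `X`. -/
def LCS.ReachConstrained (L : LCS Q C M) (X : Set Q) (s t : Conf Q C M) : Prop :=
  L.ReachWithin X s t ∧ t.1 ∈ X

/-- `X` is safe for `A`. -/
def LCS.IsSafeFor (L : LCS Q C M) (A X : Set Q) : Prop :=
  X ⊆ A ∧ ∀ x ∈ X, ∃ t, L.Step (x, eps C M) t ∧ t.1 ∈ X

/-- `Safe(A)`: the largest set safe for `A` (the union of all such sets). -/
def LCS.Safe (L : LCS Q C M) (A : Set Q) : Set Q := ⋃₀ {X | L.IsSafeFor A X}

/-- `X` is promising for `A`. -/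
def LCS.IsPromisingFor (L : LCS Q C M) (A X : Set Q) : Prop :=
  ∀ x ∈ X, ∃ t, L.ReachWithin X (x, eps C M) t ∧ t.1 ∈ A

/-- `Prom(A)`: the largest set promising for `A` (the union of all such sets). -/
def LCS.Prom (L : LCS Q C M) (A : Set Q) : Set Q := ⋃₀ {X | L.IsPromisingFor A X}

/-! ## NPLCS and the induced Markov decision process -/

/-- An NPLCS: an LCS together with a fault rate `τ ∈ (0,1)`. -/
structure NPLCS (Q C M : Type) : Type where
  L : LCS Q C M
  τ : ℝ
  τ_pos : 0 < τ
  τ_lt_one : τ < 1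

/-- The number of embeddings of the second list as a subword of the first. -/
def countEmb [DecidableEq M] : List M → List M → ℕ
  | _, [] => 1
  | [], _ :: _ => 0
  | a :: v, b :: w => (if a = b then countEmb v w else 0) + countEmb v (b :: w)

variable [Fintype C] [DecidableEq M]

/-- Total number of messages in the channels. -/
def chansSize (w : Chans C M) : ℕ := ∑ c, (w c).length

/-- `P_lost(v,v') = τ^(|v|-|v'|) · (1-τ)^|v'| · C(v,v')`, the probability that
channel contents `v` become `v'` through message losses. -/
noncomputable def plost (τ : ℝ) (v v' : Chans C M) : ℝ≥0∞ :=
  ENNReal.ofReal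
    (τ ^ (chansSize v - chansSize v') * (1 - τ) ^ chansSize v' *
      (∏ c, countEmb (v c) (v' c) : ℕ))

/-- One-step probability `P_N(s, δ, t)` of the MDP of an NPLCS. -/
noncomputable def NPLCS.stepProb (N : NPLCS Q C M) (s : Conf Q C M)
    (δ : LcsRule Q C M) (t : Conf Q C M) : ℝ≥0∞ :=
  if δ ∈ N.L.rules ∧ δ.EnabledIn s ∧ t.1 = δ.dst then
    plost N.τ (applyOp δ.op s.2) t.2
  else 0

/-! ## Probability measure of a countable-state Markov chain

Given one-step probabilities `k` on a state space `S`, the measure of a set of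
trajectories is the Carathéodory outer measure generated by the probabilities
of cylinder sets; it agrees with the usual Markov-chain measure on all
measurable (in particular, on all ω-regular) sets of trajectories. -/

section Chain
variable {S : Type}

/-- Probability that the chain starting in `s` performs the finite sequence
of steps through the configurations listed in `l`. -/
noncomputable def chainPathProb (k : S → S → ℝ≥0∞) : S → List S → ℝ≥0∞
  | _, [] => 1
  | s, t :: l => k s t * chainPathProb k t l

/-- The cylinder of trajectories starting with `s` followed by `l`. -/
def chainCyl (s : S) (l : List S) : Set (ℕ → S) :=
  {ω | ω 0 = s ∧ ∀ (i : ℕ) (h : i < l.length), ω (i + 1) = l.get ⟨i, h⟩}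

/-- Premeasure: probability of a cylinder set, `∞` on other (nonempty) sets. -/
noncomputable def chainFun (k : S → S → ℝ≥0∞) (s : S) (A : Set (ℕ → S)) : ℝ≥0∞ :=
  if A = ∅ then 0 else ⨅ (l : List S) (_ : A = chainCyl s l), chainPathProb k s l

theorem chainFun_empty (k : S → S → ℝ≥0∞) (s : S) : chainFun k s ∅ = 0 := by
  simp [chainFun]

/-- The probability, for the Markov chain with one-step probabilities `k`
started in `s`, of the set `E` of trajectories (paths starting in `s`). -/
noncomputable def chainPr (k : S → S → ℝ≥0∞) (s : S) (E : Set (ℕ → S)) : ℝ≥0∞ :=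
  MeasureTheory.OuterMeasure.ofFunction (chainFun k s) (chainFun_empty k s)
    (E ∩ {ω | ω 0 = s})

end Chain

/-! ## Schedulers -/

/-- A (history-dependent, deterministic) scheduler: given the history
`h = s₁ → ⋯ → s_{n-1}` and the current configuration `sₙ`, it chooses a
transition rule of `N` enabled in `sₙ`. -/
structure Scheduler (N : NPLCS Q C M) : Type where
  choose : List (Conf Q C M) → Conf Q C M → LcsRule Q C M
  choose_mem : ∀ h s, choose h s ∈ N.L.rules
  choose_enabled : ∀ h s, (choose h s).EnabledIn s

variable {N : NPLCS Q C M}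

/-- The Markov chain `MC_U` induced by a scheduler: its states are finite
paths, represented as (history, current configuration). -/
noncomputable def Scheduler.kernel (U : Scheduler N) :
    List (Conf Q C M) × Conf Q C M → List (Conf Q C M) × Conf Q C M → ℝ≥0∞ :=
  fun a b =>
    if b.1 = a.1 ++ [a.2] then N.stepProb a.2 (U.choose a.1 a.2) b.2 else 0

/-- `Pr_U(s ⊨ E)`: the probability, under scheduler `U` with starting
configuration `s`, of the set `E` of infinite paths (trajectories of
configurations). -/
noncomputable def Scheduler.Pr (U : Scheduler N) (s : Conf Q C M)
    (E : Set (ℕ → Conf Q C M)) : ℝ≥0∞ :=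
  chainPr U.kernel ([], s) {ω | (fun i => (ω i).2) ∈ E}

/-- Memoryless scheduler: the decision depends only on the current
configuration. -/
def Scheduler.Memoryless (U : Scheduler N) : Prop :=
  ∀ h h' s, U.choose h s = U.choose h' s

/-- Blind scheduler: the decision depends only on the sequence of locations
that have been visited. -/
def Scheduler.Blind (U : Scheduler N) : Prop :=
  ∀ h h' s s', h.map Prod.fst = h'.map Prod.fst → s.1 = s'.1 →
    U.choose h s = U.choose h' s'

/-- Finite-memory scheduler data: finitely many modes, a starting mode, a
decision rule and a next-mode function. -/
structure FMScheduler (N : NPLCS Q C M) : Type 1 where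
  Mode : Type
  modeFin : Fintype Mode
  init : Mode
  D : Mode → Conf Q C M → LcsRule Q C M
  upd : Mode → Conf Q C M → Mode
  D_mem : ∀ u s, D u s ∈ N.L.rules
  D_enabled : ∀ u s, (D u s).EnabledIn s

/-- A scheduler is finite-memory if it is induced by finite-memory data. -/
def Scheduler.FiniteMemory (U : Scheduler N) : Prop :=
  ∃ fm : FMScheduler N, ∀ h s, U.choose h s = fm.D (h.foldl fm.upd fm.init) s

/-- The Markov chain `MC_U` of a finite-memory scheduler: states are pairs
`s_u` of a configuration `s` and a mode `u`. -/
noncomputable def FMScheduler.kernel (fm : FMScheduler N) :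
    Conf Q C M × fm.Mode → Conf Q C M × fm.Mode → ℝ≥0∞ :=
  fun a b =>
    if b.2 = fm.upd a.2 a.1 then N.stepProb a.1 (fm.D a.2 a.1) b.1 else 0

/-- Probability measure of the Markov chain `MC_U` of a finite-memory
scheduler, over trajectories of (configuration, mode) states. -/
noncomputable def FMScheduler.PrMC (fm : FMScheduler N)
    (a : Conf Q C M × fm.Mode) (E : Set (ℕ → Conf Q C M × fm.Mode)) : ℝ≥0∞ :=
  chainPr fm.kernel a E

/-- Reachability in the Markov chain `MC_U` of a finite-memory scheduler. -/
def FMScheduler.MCReach (fm : FMScheduler N) :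
    Conf Q C M × fm.Mode → Conf Q C M × fm.Mode → Prop :=
  Relation.ReflTransGen (fun a b => 0 < fm.kernel a b)

/-- The history (the first `i` configurations) of a trajectory. -/
def histTo (ω : ℕ → Conf Q C M) (i : ℕ) : List (Conf Q C M) :=
  (List.range i).map ω

/-- Almost blind scheduler: there are a scheduler `W` and a blind scheduler
`V` such that from any starting configuration, almost surely the choices of
`U` along the path agree with those of `W` up to some finite time and with
those of `V` afterwards. -/
def Scheduler.AlmostBlind (U : Scheduler N) : Prop :=
  ∃ W V : Scheduler N, V.Blind ∧ ∀ s : Conf Q C M,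
    U.Pr s {ω | ∃ n : ℕ,
      (∀ i ≤ n, U.choose (histTo ω i) (ω i) = W.choose (histTo ω i) (ω i)) ∧
      (∀ i, n < i → U.choose (histTo ω i) (ω i) = V.choose (histTo ω i) (ω i))} = 1

/-! ## LTL-style events on trajectories -/

/-- `□P` -/
def evAlways {α : Type} (P : α → Prop) : Set (ℕ → α) := {ω | ∀ i, P (ω i)}

/-- `◇P` -/
def evEventually {α : Type} (P : α → Prop) : Set (ℕ → α) := {ω | ∃ i, P (ω i)}

/-- `□◇P` -/
def evInfOften {α : Type} (P : α → Prop) : Set (ℕ → α) :=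
  {ω | ∀ n, ∃ i, n ≤ i ∧ P (ω i)}

/-- `◇□P` -/
def evEvAlways {α : Type} (P : α → Prop) : Set (ℕ → α) :=
  {ω | ∃ n, ∀ i, n ≤ i → P (ω i)}

/-- The atomic proposition "the current location belongs to `A`". -/
def inLoc (A : Set Q) : Conf Q C M → Prop := fun s => s.1 ∈ A


set_option linter.unusedSectionVars false

/-! ## Message losses define a probability distribution -/

section Losses

theorem countEmb_eq_zero :
    ∀ v w : List M, v.length < w.length → countEmb v w = 0
  | _, [], h => by simp at h
  | [], _ :: _, _ => by simp [countEmb]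
  | a :: v, b :: w, h => by
    have h1 : v.length < w.length := by simpa using h
    have h2 : v.length < (b :: w).length := by simp; omega
    simp [countEmb, countEmb_eq_zero v w h1, countEmb_eq_zero v (b :: w) h2]

/-- The probability that the word `v` becomes `w` through message losses. -/
noncomputable def wordLost (τ : ℝ) (v w : List M) : ℝ :=
  τ ^ (v.length - w.length) * (1 - τ) ^ w.length * countEmb v w

theorem wordLost_nonneg {τ : ℝ} (h0 : 0 < τ) (h1 : τ < 1) (v w : List M) :
    0 ≤ wordLost τ v w := by
  have : 0 ≤ 1 - τ := by linarith
  unfold wordLost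
  positivity

theorem wordLost_nil_cons (τ : ℝ) (b : M) (w : List M) : wordLost τ [] (b :: w) = 0 := by
  simp [wordLost, countEmb]

theorem wordLost_cons_nil (τ : ℝ) (a : M) (v : List M) :
    wordLost τ (a :: v) [] = τ * wordLost τ v [] := by
  simp [wordLost, countEmb, pow_succ, mul_comm]

theorem wordLost_cons_cons (τ : ℝ) (a b : M) (v w : List M) :
    wordLost τ (a :: v) (b :: w) =
      (if a = b then (1 - τ) * wordLost τ v w else 0) + τ * wordLost τ v (b :: w) := by
  have key : τ ^ (v.length - w.length) * (countEmb v (b :: w) : ℝ) =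
      τ * τ ^ (v.length - (w.length + 1)) * countEmb v (b :: w) := by
    by_cases h : v.length < w.length + 1
    · rw [countEmb_eq_zero v (b :: w) (by simpa using h)]
      simp
    · rw [← pow_succ']
      congr 2
      omega
  simp only [wordLost, countEmb, List.length_cons, Nat.add_sub_add_right, Nat.cast_add]
  split_ifs
  · linear_combination (1 - τ) ^ (w.length + 1) * key
  · push_cast
    linear_combination (1 - τ) ^ (w.length + 1) * key

theorem hasSum_wordLost (τ : ℝ) (v : List M) : HasSum (wordLost τ v) 1 := by
  induction v with
  | nil =>
    convert hasSum_ite_eq ([] : List M) (1 : ℝ) using 1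
    funext w
    cases w with
    | nil => simp [wordLost, countEmb]
    | cons b w => simp [wordLost_nil_cons]
  | cons a v ih =>
    have inj : Function.Injective (List.cons a) := List.cons_injective
    have h1 := (Function.Injective.hasSum_iff (a := (1 - τ) * 1)
      (f := Function.extend (List.cons a) (fun w => (1 - τ) * wordLost τ v w) 0) inj
      (fun x hx => by
        rw [Function.extend_apply' _ _ _ (by simpa using hx)]; rfl)).1 (by
        rw [Function.extend_comp inj]
        exact ih.mul_left _)
    have h2 := h1.add (ih.mul_left τ)
    convert h2 using 1
    · funext w
      cases w with
      | nil =>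
        rw [wordLost_cons_nil, Function.extend_apply' _ _ _ (by simp)]
        simp
      | cons b w =>
        rw [wordLost_cons_cons]
        congr 1
        split_ifs with h
        · subst h
          rw [inj.extend_apply]
        · rw [Function.extend_apply' _ _ _ (by rintro ⟨x, hx⟩; simp_all)]
          rfl
    · ring

theorem wordLost_support_finite (τ : ℝ) (v : List M) : (Function.support (wordLost τ v)).Finite := by
  induction v with
  | nil =>
    refine (Set.finite_singleton ([] : List M)).subset fun w hw => ?_
    cases w with
    | nil => rfl
    | cons b w => exact absurd (wordLost_nil_cons τ b w) hw
  | cons a v ih =>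
    refine (ih.union (ih.image (List.cons a))).subset fun w hw => ?_
    by_contra hcon
    simp only [Set.mem_union, Set.mem_image, Function.mem_support, not_or, not_not] at hcon
    obtain ⟨h1, h2⟩ := hcon
    apply hw
    cases w with
    | nil => rw [wordLost_cons_nil, h1, mul_zero]
    | cons b w =>
      rw [wordLost_cons_cons, h1]
      split_ifs with hab
      · subst hab
        have : wordLost τ v w = 0 := by
          by_contra h
          exact h2 ⟨w, h, rfl⟩
        simp [this]
      · simp

theorem plost_eq_prod {τ : ℝ} (v w : Chans C M) :
    plost τ v w = ENNReal.ofReal (∏ c, wordLost τ (v c) (w c)) := by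
  unfold plost
  congr 1
  simp only [wordLost, Finset.prod_mul_distrib, Finset.prod_pow_eq_pow_sum, chansSize,
    Nat.cast_prod]
  by_cases h : ∀ c, (w c).length ≤ (v c).length
  · rw [Finset.sum_tsub_distrib _ fun c _ => h c]
  · push Not at h
    obtain ⟨c, hc⟩ := h
    rw [Finset.prod_eq_zero (Finset.mem_univ c) (by rw [countEmb_eq_zero _ _ hc]; simp)]
    simp

theorem tsum_plost {τ : ℝ} (h0 : 0 < τ) (h1 : τ < 1) (v : Chans C M) :
    ∑' w, plost τ v w = 1 := by
  let T : C → Finset (List M) := fun c => (wordLost_support_finite τ (v c)).toFinset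
  have hT : ∀ c, ∑ w ∈ T c, wordLost τ (v c) w = 1 := fun c =>
    (hasSum_sum_of_ne_finset_zero (fun w hw => by simpa [T] using hw)).unique
      (hasSum_wordLost τ (v c))
  rw [tsum_eq_sum (s := Fintype.piFinset T)]
  · simp only [plost_eq_prod]
    rw [← ENNReal.ofReal_sum_of_nonneg
      fun w _ => Finset.prod_nonneg fun c _ => wordLost_nonneg h0 h1 _ _,
      ← Finset.prod_univ_sum]
    simp [hT]
  · intro w hw
    simp only [Fintype.mem_piFinset, not_forall] at hw
    obtain ⟨c, hc⟩ := hw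
    rw [plost_eq_prod, Finset.prod_eq_zero (Finset.mem_univ c) (by simpa [T] using hc)]
    simp

theorem plost_eps_pos {τ : ℝ} (h0 : 0 < τ) (v : Chans C M) : 0 < plost τ v (eps C M) := by
  have h (l : List M) : countEmb l [] = 1 := by cases l <;> rfl
  simp [plost, eps, chansSize, h, ENNReal.ofReal_pos, h0]

end Losses

/-! ## Markov chains -/

section MarkovChain

variable {S : Type}

theorem chainPathProb_concat (k : S → S → ℝ≥0∞) (l : List S) (s t : S) :
    chainPathProb k s (l ++ [t]) = chainPathProb k s l * k (l.getLastD s) t := by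
  induction l generalizing s with
  | nil => simp [chainPathProb]
  | cons u l ih =>
    rw [List.cons_append, chainPathProb, ih, chainPathProb, List.getLastD_cons, mul_assoc]

/-- The first `j` states of a trajectory after its starting state. -/
def trajPrefix (ω : ℕ → S) (j : ℕ) : List S := (List.range j).map fun i => ω (i + 1)

theorem trajPrefix_succ (ω : ℕ → S) (j : ℕ) :
    trajPrefix ω (j + 1) = trajPrefix ω j ++ [ω (j + 1)] := by
  simp [trajPrefix, List.range_succ]

theorem getLastD_trajPrefix (ω : ℕ → S) (j : ℕ) : (trajPrefix ω j).getLastD (ω 0) = ω j := by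
  cases j with
  | zero => rfl
  | succ j => simp [trajPrefix_succ]

theorem mem_chainCyl_trajPrefix (ω : ℕ → S) (j : ℕ) :
    ω ∈ chainCyl (ω 0) (trajPrefix ω j) := by
  simp [chainCyl, trajPrefix]

theorem chainFun_chainCyl_le (k : S → S → ℝ≥0∞) (s : S) (l : List S) :
    chainFun k s (chainCyl s l) ≤ chainPathProb k s l := by
  unfold chainFun
  split_ifs
  · exact zero_le
  · exact iInf_le_of_le l (iInf_le _ rfl)

theorem chainPathProb_trajPrefix_pos {k : S → S → ℝ≥0∞} {ω : ℕ → S}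
    (h : ∀ i, 0 < k (ω i) (ω (i + 1))) (j : ℕ) :
    0 < chainPathProb k (ω 0) (trajPrefix ω j) := by
  induction j with
  | zero => simp [trajPrefix, chainPathProb]
  | succ j ih =>
    rw [trajPrefix_succ, chainPathProb_concat, getLastD_trajPrefix]
    exact ENNReal.mul_pos ih.ne' (h j).ne'

theorem chainPr_add_chainPathProb_le_one [Countable S] {k : S → S → ℝ≥0∞}
    (hk : ∀ s, ∑' t, k s t = 1) (ω : ℕ → S) (j : ℕ) :
    chainPr k (ω 0) {x | ∃ i ≤ j, x i ≠ ω i} + chainPathProb k (ω 0) (trajPrefix ω j) ≤ 1 := by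
  induction j with
  | zero =>
    have : {x : ℕ → S | ∃ i ≤ 0, x i ≠ ω i} ∩ {x | x 0 = ω 0} = ∅ := by
      ext x
      simp
    rw [chainPr, this]
    simp [trajPrefix, chainPathProb]
  | succ j ih =>
    set m := MeasureTheory.OuterMeasure.ofFunction (chainFun k (ω 0)) (chainFun_empty k (ω 0))
      with hm
    set l := trajPrefix ω j with hl
    have hsub : {x : ℕ → S | ∃ i ≤ j + 1, x i ≠ ω i} ∩ {x | x 0 = ω 0} ⊆
        ({x | ∃ i ≤ j, x i ≠ ω i} ∩ {x | x 0 = ω 0}) ∪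
          ⋃ t : {t : S // t ≠ ω (j + 1)}, chainCyl (ω 0) (l ++ [t.1]) := by
      rintro x ⟨⟨i, hi, hx⟩, hx0⟩
      by_cases hag : ∃ i ≤ j, x i ≠ ω i
      · exact Or.inl ⟨hag, hx0⟩
      · push Not at hag
        have hij : i = j + 1 := by
          by_contra hne
          exact hx (hag i (by omega))
        subst hij
        refine Or.inr (Set.mem_iUnion.2 ⟨⟨x (j + 1), hx⟩, ?_⟩)
        have : l = trajPrefix x j := by
          rw [hl]
          refine List.map_congr_left fun i hi => (hag (i + 1) ?_).symm
          simpa using hi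
        rw [this, ← trajPrefix_succ, ← hx0]
        exact mem_chainCyl_trajPrefix x (j + 1)
    have hcyl : m (⋃ t : {t : S // t ≠ ω (j + 1)}, chainCyl (ω 0) (l ++ [t.1])) ≤
        ∑' t : {t : S // t ≠ ω (j + 1)}, chainPathProb k (ω 0) (l ++ [t.1]) :=
      (MeasureTheory.measure_iUnion_le _).trans (ENNReal.tsum_le_tsum fun t =>
        (MeasureTheory.OuterMeasure.ofFunction_le _).trans (chainFun_chainCyl_le _ _ _))
    have htot : (∑' t : {t : S // t ≠ ω (j + 1)}, chainPathProb k (ω 0) (l ++ [t.1])) +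
        chainPathProb k (ω 0) (l ++ [ω (j + 1)]) = chainPathProb k (ω 0) l := by
      have h1 := ENNReal.summable.tsum_add_tsum_compl (s := {t : S | t = ω (j + 1)})
        (f := fun t => chainPathProb k (ω 0) (l ++ [t])) ENNReal.summable
      have h2 : ∑' t, chainPathProb k (ω 0) (l ++ [t]) = chainPathProb k (ω 0) l := by
        simp only [chainPathProb_concat, ENNReal.tsum_mul_left, hk, mul_one]
      rw [h2] at h1
      rw [← h1, add_comm]
      congr 1
      exact (tsum_singleton (ω (j + 1)) fun t => chainPathProb k (ω 0) (l ++ [t])).symm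
    calc chainPr k (ω 0) {x | ∃ i ≤ j + 1, x i ≠ ω i} +
          chainPathProb k (ω 0) (trajPrefix ω (j + 1))
        ≤ chainPr k (ω 0) {x | ∃ i ≤ j, x i ≠ ω i} +
          (∑' t : {t : S // t ≠ ω (j + 1)}, chainPathProb k (ω 0) (l ++ [t.1])) +
          chainPathProb k (ω 0) (l ++ [ω (j + 1)]) := by
          rw [trajPrefix_succ]
          gcongr
          exact (m.mono hsub).trans ((MeasureTheory.measure_union_le _ _).trans
            (add_le_add le_rfl hcyl))
      _ ≤ 1 := by rwa [add_assoc, htot]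

/-- An almost sure event contains trajectories that agree on any given initial segment with a
trajectory all of whose steps have positive probability. -/
theorem exists_mem_agree_of_chainPr_eq_one [Countable S] {k : S → S → ℝ≥0∞}
    (hk : ∀ s, ∑' t, k s t = 1) {ω : ℕ → S} (h : ∀ i, 0 < k (ω i) (ω (i + 1)))
    {E : Set (ℕ → S)} (hE : chainPr k (ω 0) E = 1) (j : ℕ) :
    ∃ x ∈ E, ∀ i ≤ j, x i = ω i := by
  by_contra hcon
  push Not at hcon
  have h1 : chainPr k (ω 0) E ≤ chainPr k (ω 0) {x | ∃ i ≤ j, x i ≠ ω i} :=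
    MeasureTheory.measure_mono fun x hx => ⟨hcon x hx.1, hx.2⟩
  rw [hE] at h1
  have h2 := (add_le_add_left h1 _).trans (chainPr_add_chainPathProb_le_one hk ω j)
  exact absurd h2 (not_le.2 (ENNReal.lt_add_right ENNReal.one_ne_top
    (chainPathProb_trajPrefix_pos h j).ne'))

/-- The probability of a cylinder, where `none` stands for the empty set. -/
noncomputable def optPathProb (k : S → S → ℝ≥0∞) (s : S) : Option (List S) → ℝ≥0∞
  | none => 0
  | some l => chainPathProb k s l

/-- The cylinder that remains after a first step to `t`. -/
noncomputable def optShift (t : S) : Option (List S) → Option (List S)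
  | none => none
  | some [] => some []
  | some (u :: l) => if t = u then some l else none

theorem tsum_mul_optPathProb {k : S → S → ℝ≥0∞} (hk : ∀ s, ∑' t, k s t = 1) (s : S)
    (c : Option (List S)) :
    ∑' t, k s t * optPathProb k t (optShift t c) = optPathProb k s c := by
  match c with
  | none => simp [optShift, optPathProb]
  | some [] => simp [optShift, optPathProb, chainPathProb, hk]
  | some (u :: l) =>
    rw [tsum_eq_single u fun t ht => by simp [optShift, ht, optPathProb]]
    simp [optShift, optPathProb, chainPathProb]

theorem exists_step_tsum_optPathProb_lt_one {k : S → S → ℝ≥0∞} (hk : ∀ s, ∑' t, k s t = 1)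
    {s : S} {c : ℕ → Option (List S)} (hc : ∑' n, optPathProb k s (c n) < 1) :
    ∃ t, 0 < k s t ∧ ∑' n, optPathProb k t (optShift t (c n)) < 1 := by
  by_contra! hcon
  refine hc.not_ge ?_
  calc (1 : ℝ≥0∞) = ∑' t, k s t := (hk s).symm
    _ ≤ ∑' t, k s t * ∑' n, optPathProb k t (optShift t (c n)) := by
      refine ENNReal.tsum_le_tsum fun t => ?_
      rcases eq_or_ne (k s t) 0 with h | h
      · simp [h]
      · exact le_mul_of_one_le_right zero_le (hcon t (pos_iff_ne_zero.2 h))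
    _ = ∑' n, optPathProb k s (c n) := by
      simp only [← ENNReal.tsum_mul_left]
      rw [ENNReal.tsum_comm]
      exact tsum_congr fun n => tsum_mul_optPathProb hk s (c n)

/-- A countable family of cylinders of total probability less than one misses a trajectory all of
whose steps have positive probability. -/
theorem exists_traj_notMem_chainCyl {k : S → S → ℝ≥0∞} (hk : ∀ s, ∑' t, k s t = 1)
    {s : S} {c : ℕ → Option (List S)} (hc : ∑' n, optPathProb k s (c n) < 1) :
    ∃ ω : ℕ → S, ω 0 = s ∧ (∀ i, 0 < k (ω i) (ω (i + 1))) ∧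
      ∀ n l, c n = some l → ω ∉ chainCyl s l := by
  let P := {p : S × (ℕ → Option (List S)) // ∑' n, optPathProb k p.1 (p.2 n) < 1}
  have hstep : ∀ p : P, ∃ p' : P, 0 < k p.1.1 p'.1.1 ∧
      ∀ n, p'.1.2 n = optShift p'.1.1 (p.1.2 n) := fun p =>
    let ⟨t, ht, ht'⟩ := exists_step_tsum_optPathProb_lt_one hk p.2
    ⟨⟨(t, fun n => optShift t (p.1.2 n)), ht'⟩, ht, fun _ => rfl⟩
  choose next hnext using hstep
  let x : ℕ → P := fun i => next^[i] ⟨(s, c), hc⟩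
  have hx : ∀ i, x (i + 1) = next (x i) := fun i => Function.iterate_succ_apply' _ _ _
  have hmiss : ∀ (l : List S) (i n : ℕ), (x i).1.2 n = some l →
      ¬ ∀ (a : ℕ) (h : a < l.length), (x (i + (a + 1))).1.1 = l.get ⟨a, h⟩ := by
    intro l
    induction l with
    | nil =>
      intro i n hn _
      refine (x i).2.not_ge ?_
      calc (1 : ℝ≥0∞) = optPathProb k (x i).1.1 ((x i).1.2 n) := by
            simp [hn, optPathProb, chainPathProb]
        _ ≤ _ := ENNReal.le_tsum n
    | cons u l ih =>
      intro i n hn hfol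
      refine ih (i + 1) n ?_ fun a h => ?_
      · have h0 : (x (i + 1)).1.1 = u := hfol 0 (by simp)
        rw [hx, (hnext (x i)).2, ← hx, hn, h0]
        simp [optShift]
      · have := hfol (a + 1) (by simpa using h)
        rw [show i + 1 + (a + 1) = i + (a + 1 + 1) by omega, this]
        rfl
  refine ⟨fun i => (x i).1.1, rfl, fun i => ?_, fun n l hn hmem => hmiss l 0 n hn fun a h => ?_⟩
  · show 0 < k (x i).1.1 (x (i + 1)).1.1
    rw [hx]
    exact (hnext (x i)).1
  · simpa using hmem.2 a h

theorem chainPr_le_one (k : S → S → ℝ≥0∞) (s : S) (E : Set (ℕ → S)) : chainPr k s E ≤ 1 := by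
  have hsub : E ∩ {ω | ω 0 = s} ⊆ chainCyl s [] := fun ω hω => ⟨hω.2, by simp⟩
  exact (MeasureTheory.measure_mono hsub).trans
    ((MeasureTheory.OuterMeasure.ofFunction_le _).trans (chainFun_chainCyl_le k s []))

theorem chainPr_eq_one_of_forall_traj_mem {k : S → S → ℝ≥0∞} (hk : ∀ s, ∑' t, k s t = 1) {s : S}
    {E : Set (ℕ → S)} (hE : ∀ ω : ℕ → S, ω 0 = s → (∀ i, 0 < k (ω i) (ω (i + 1))) → ω ∈ E) :
    chainPr k s E = 1 := by
  refine le_antisymm (chainPr_le_one k s E) ?_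
  rw [chainPr, MeasureTheory.OuterMeasure.ofFunction_apply]
  refine le_iInf₂ fun A hA => ?_
  by_contra! hlt
  obtain ⟨ε, hε, hεsum⟩ := ENNReal.exists_pos_sum_of_countable' (tsub_pos_of_lt hlt).ne' ℕ
  have hcover : ∀ n, ∃ c : Option (List S), optPathProb k s c ≤ chainFun k s (A n) + ε n ∧
      ∀ ω ∈ A n, ∃ l, c = some l ∧ ω ∈ chainCyl s l := by
    intro n
    rcases (A n).eq_empty_or_nonempty with h | h
    · exact ⟨none, by simp [optPathProb], by simp [h]⟩
    · have hfin : chainFun k s (A n) < chainFun k s (A n) + ε n :=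
        ENNReal.lt_add_right
          (((ENNReal.le_tsum n).trans_lt hlt).trans ENNReal.one_lt_top).ne (hε n).ne'
      conv_lhs at hfin => rw [chainFun, if_neg h.ne_empty]
      simp only [iInf_lt_iff] at hfin
      obtain ⟨l, hl, hlp⟩ := hfin
      exact ⟨some l, hlp.le, fun ω hω => ⟨l, rfl, hl ▸ hω⟩⟩
  choose c hc hcA using hcover
  have hsum : ∑' n, optPathProb k s (c n) < 1 :=
    calc ∑' n, optPathProb k s (c n) ≤ ∑' n, (chainFun k s (A n) + ε n) :=
          ENNReal.tsum_le_tsum hc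
      _ = ∑' n, chainFun k s (A n) + ∑' n, ε n := ENNReal.tsum_add
      _ < 1 := by rw [add_comm]; exact lt_tsub_iff_right.1 hεsum
  obtain ⟨ω, h0, hpos, hω⟩ := exists_traj_notMem_chainCyl hk hsum
  obtain ⟨n, hn⟩ := Set.mem_iUnion.1 (hA ⟨hE ω h0 hpos, h0⟩)
  obtain ⟨l, hl, hmem⟩ := hcA n ω hn
  exact hω n l hl hmem

end MarkovChain

/-! ## Schedulers -/

section SchedulerLemmas

theorem NPLCS.tsum_stepProb {s : Conf Q C M} {δ : LcsRule Q C M} (hδ : δ ∈ N.L.rules)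
    (hs : δ.EnabledIn s) : ∑' t, N.stepProb s δ t = 1 := by
  rw [ENNReal.tsum_prod', tsum_eq_single δ.dst fun p hp => by simp [NPLCS.stepProb, hp]]
  simp only [NPLCS.stepProb, hδ, hs, true_and, if_true]
  exact tsum_plost N.τ_pos N.τ_lt_one _

theorem Scheduler.tsum_kernel (U : Scheduler N) (a : List (Conf Q C M) × Conf Q C M) :
    ∑' b, U.kernel a b = 1 := by
  rw [ENNReal.tsum_prod', tsum_eq_single (a.1 ++ [a.2]) fun h hh => by simp [kernel, hh]]
  simp only [kernel, if_true]
  exact NPLCS.tsum_stepProb (U.choose_mem _ _) (U.choose_enabled _ _)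

/-- The trajectory of the induced chain in which all messages are lost in every step. -/
noncomputable def Scheduler.lossTraj (U : Scheduler N) (q : Q) :
    ℕ → List (Conf Q C M) × Conf Q C M
  | 0 => ([], (q, eps C M))
  | i + 1 => ((U.lossTraj q i).1 ++ [(U.lossTraj q i).2],
      ((U.choose (U.lossTraj q i).1 (U.lossTraj q i).2).dst, eps C M))

theorem Scheduler.snd_lossTraj (U : Scheduler N) (q : Q) (i : ℕ) :
    (U.lossTraj q i).2.2 = eps C M := by
  cases i <;> rfl

theorem Scheduler.kernel_lossTraj_pos (U : Scheduler N) (q : Q) (i : ℕ) :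
    0 < U.kernel (U.lossTraj q i) (U.lossTraj q (i + 1)) := by
  simp only [kernel, lossTraj, if_true, NPLCS.stepProb, U.choose_mem, U.choose_enabled, true_and]
  exact plost_eps_pos N.τ_pos _

theorem enabledOp_of_enabledOp_eps {op : LcsOp C M} (h : enabledOp op (eps C M))
    (w : Chans C M) : enabledOp op w := by
  cases op with
  | send c m => trivial
  | recv c m => exact absurd h (by simp [enabledOp, eps])
  | internal => trivial

theorem enabledOp_eps_of_not_isRecv {op : LcsOp C M} (h : ¬ op.IsRecv) :
    enabledOp op (eps C M) := by
  cases op with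
  | send c m => trivial
  | recv c m => exact absurd trivial h
  | internal => trivial

/-- From a safe set, a blind and memoryless scheduler stays in that set almost surely. -/
theorem exists_blind_memoryless_of_isSafeFor {A X : Set Q} (hX : N.L.IsSafeFor A X) {q : Q}
    (hq : q ∈ X) : ∃ U : Scheduler N, U.Blind ∧ U.Memoryless ∧
      U.Pr (q, eps C M) (evAlways (inLoc A)) = 1 := by
  have hrule : ∀ p : Q, ∃ δ ∈ N.L.rules, δ.src = p ∧ enabledOp δ.op (eps C M) ∧
      (p ∈ X → δ.dst ∈ X) := by
    intro p
    by_cases hp : p ∈ X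
    · obtain ⟨t, ⟨δ, hδ, hen, hdst, -⟩, ht⟩ := hX.2 p hp
      exact ⟨δ, hδ, hen.1, hen.2, fun _ => hdst ▸ ht⟩
    · obtain ⟨δ, hδ, hsrc, hrecv⟩ := N.L.noDeadlock p
      exact ⟨δ, hδ, hsrc, enabledOp_eps_of_not_isRecv hrecv, fun h => absurd h hp⟩
  choose r hmem hsrc hen hdst using hrule
  let U : Scheduler N :=
    { choose := fun _ s => r s.1
      choose_mem := fun _ s => hmem s.1
      choose_enabled := fun _ s => ⟨hsrc s.1, enabledOp_of_enabledOp_eps (hen s.1) s.2⟩ }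
  refine ⟨U, fun _ _ _ _ _ h => congrArg r h, fun _ _ _ => rfl, ?_⟩
  refine chainPr_eq_one_of_forall_traj_mem U.tsum_kernel fun ω h0 hpos i => ?_
  suffices h : (ω i).2.1 ∈ X from hX.1 h
  induction i with
  | zero => simpa [h0] using hq
  | succ i ih =>
    have h := hpos i
    simp only [Scheduler.kernel, NPLCS.stepProb] at h
    split_ifs at h with h1 h2
    · rw [h2.2.2]
      exact hdst _ ih
    · exact absurd h (lt_irrefl _)
    · exact absurd h (lt_irrefl _)

/-- The locations visited when all messages are lost in every step form a safe set. -/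
theorem Scheduler.isSafeFor_range_lossTraj (U : Scheduler N) (q : Q) {A : Set Q}
    (hA : ∀ i, (U.lossTraj q i).2.1 ∈ A) :
    N.L.IsSafeFor A (Set.range fun i => (U.lossTraj q i).2.1) := by
  refine ⟨by rintro _ ⟨i, rfl⟩; exact hA i, ?_⟩
  rintro _ ⟨i, rfl⟩
  have hs : (U.lossTraj q i).2 = ((U.lossTraj q i).2.1, eps C M) :=
    Prod.ext rfl (U.snd_lossTraj q i)
  refine ⟨(U.lossTraj q (i + 1)).2, ⟨U.choose (U.lossTraj q i).1 (U.lossTraj q i).2,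
    U.choose_mem _ _, ?_, rfl, fun c => ?_⟩, ⟨i + 1, rfl⟩⟩
  · rw [← hs]
    exact U.choose_enabled _ _
  · rw [U.snd_lossTraj]
    exact List.nil_sublist _

end SchedulerLemmas

/-- Some scheduler satisfies `⋁ᵢ □Bᵢ` almost surely from `(q,ε)` iff some
blind and memoryless scheduler satisfies `□Bᵢ` almost surely for some `i`. -/
theorem statement7 {Q C M : Type} [Fintype Q] [Fintype C] [DecidableEq C]
    [Fintype M] [DecidableEq M] (N : NPLCS Q C M) (q : Q) (n : ℕ)
    (B : Fin n → Set Q) :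
    (∃ U : Scheduler N,
        U.Pr (q, eps C M) (⋃ i, evAlways (inLoc (B i))) = 1)
    ↔ (∃ i : Fin n, ∃ U' : Scheduler N, U'.Blind ∧ U'.Memoryless ∧
        U'.Pr (q, eps C M) (evAlways (inLoc (B i))) = 1) := by
  constructor
  · rintro ⟨U, hU⟩
    by_cases hsafe : ∃ i, ∀ j, (U.lossTraj q j).2.1 ∈ B i
    · obtain ⟨i, hi⟩ := hsafe
      exact ⟨i, exists_blind_memoryless_of_isSafeFor (U.isSafeFor_range_lossTraj q hi) ⟨0, rfl⟩⟩
    · push Not at hsafe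
      choose j hj using hsafe
      obtain ⟨x, hx, hag⟩ := exists_mem_agree_of_chainPr_eq_one U.tsum_kernel
        (U.kernel_lossTraj_pos q) hU (Finset.univ.sup j)
      obtain ⟨i, hi⟩ := Set.mem_iUnion.1 hx
      have h : (x (j i)).2.1 ∈ B i := hi (j i)
      rw [hag (j i) (Finset.le_sup (Finset.mem_univ i))] at h
      exact absurd h (hj i)
  · rintro ⟨i, U, -, -, hU⟩
    refine ⟨U, le_antisymm (chainPr_le_one _ _ _) (hU.symm.le.trans ?_)⟩
    exact MeasureTheory.measure_mono fun ω hω => ⟨Set.mem_iUnion.2 ⟨i, hω.1⟩, hω.2⟩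

end NPLCSmodel
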